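/- Let d ≥ 1 and m ≥ 2d+2 be integers, let H = {h_0 < h_1 < … < h_{2d+1}} be a (2d+2)-element subset of {1, …, m}, and set A = {h_0, h_2, …, h_{2d}} and B = {h_1, h_3, …, h_{2d+1}}. Let 𝒯 be a triangulation of C(m, 2d) with L(H) ⊆ 𝒯 and let 𝒯' = (𝒯 ∖ L(H)) ∪ U(H) be the increasing bistellar flip of 𝒯 at H. Then 𝒯' is a triangulation of C(m, 2d), and the set of d-faces of 𝒯' contained in no lower facet of C(m, 2d) is obtained from the set of d-faces of 𝒯 contained in no lower facet of C(m, 2d) by removing A and adding B. -/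

import Mathlib

open Finset

noncomputable section

/-- The moment curve `p_δ(t) = (t, t², …, t^δ)` in `ℝ^δ`. -/
def momCurve (δ : ℕ) (t : ℝ) : Fin δ → ℝ := fun i => t ^ (i.1 + 1)

/-- The points `p_δ(a)` on the moment curve for `a` ranging over a finite set of naturals. -/
def momPts (δ : ℕ) (A : Finset ℕ) : Set (Fin δ → ℝ) :=
  (fun a : ℕ => momCurve δ (a : ℝ)) '' (A : Set ℕ)

/-- The simplex `|A|_δ`, i.e. the convex hull of the points `p_δ(a)`, `a ∈ A`. -/
def smp (δ : ℕ) (A : Finset ℕ) : Set (Fin δ → ℝ) := convexHull ℝ (momPts δ A)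

/-- The cyclic polytope `C(m, δ) = conv{p_δ(1), …, p_δ(m)}`. -/
def cyc (m δ : ℕ) : Set (Fin δ → ℝ) := smp δ (Finset.Icc 1 m)

/-- The last standard basis vector `e_δ` of `ℝ^δ`. -/
def eLast (δ : ℕ) : Fin δ → ℝ := fun i => if i.1 = δ - 1 then 1 else 0

/-- The last coordinate of a point of `ℝ^δ`. -/
def lastCoord {δ : ℕ} (x : Fin δ → ℝ) : ℝ :=
  if h : 0 < δ then x ⟨δ - 1, Nat.sub_lt h one_pos⟩ else 0

/-- `x` lies strictly above `V`: `x - r • e_δ ∈ V` for some `r > 0`. -/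
def StrictlyAbove {δ : ℕ} (x : Fin δ → ℝ) (V : Set (Fin δ → ℝ)) : Prop :=
  ∃ r : ℝ, 0 < r ∧ x - r • eLast δ ∈ V

/-- `x` lies strictly below `V`: `x - r • e_δ ∈ V` for some `r < 0`. -/
def StrictlyBelow {δ : ℕ} (x : Fin δ → ℝ) (V : Set (Fin δ → ℝ)) : Prop :=
  ∃ r : ℝ, r < 0 ∧ x - r • eLast δ ∈ V

/-- `|F|_δ` is a lower facet of the cyclic polytope `C(m, δ)`. -/
def IsLowerFacet (m δ : ℕ) (F : Finset ℕ) : Prop :=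
  F ⊆ Finset.Icc 1 m ∧ F.card = δ ∧
    ∀ i ∈ Finset.Icc 1 m, i ∉ F →
      StrictlyAbove (momCurve δ (i : ℝ))
        ((affineSpan ℝ (momPts δ F) : AffineSubspace ℝ (Fin δ → ℝ)) : Set (Fin δ → ℝ))

/-- `|F|_δ` is an upper facet of the cyclic polytope `C(m, δ)`. -/
def IsUpperFacet (m δ : ℕ) (F : Finset ℕ) : Prop :=
  F ⊆ Finset.Icc 1 m ∧ F.card = δ ∧
    ∀ i ∈ Finset.Icc 1 m, i ∉ F →
      StrictlyBelow (momCurve δ (i : ℝ))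
        ((affineSpan ℝ (momPts δ F) : AffineSubspace ℝ (Fin δ → ℝ)) : Set (Fin δ → ℝ))

/-- The facet `|H ∖ {c}|_δ` of the simplex `|H|_δ` is a lower facet of `|H|_δ`. -/
def IsLowerFacetOfSimplex (δ : ℕ) (H : Finset ℕ) (c : ℕ) : Prop :=
  c ∈ H ∧ StrictlyAbove (momCurve δ (c : ℝ))
    ((affineSpan ℝ (momPts δ (H.erase c)) : AffineSubspace ℝ (Fin δ → ℝ)) : Set (Fin δ → ℝ))

/-- The facet `|H ∖ {c}|_δ` of the simplex `|H|_δ` is an upper facet of `|H|_δ`. -/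
def IsUpperFacetOfSimplex (δ : ℕ) (H : Finset ℕ) (c : ℕ) : Prop :=
  c ∈ H ∧ StrictlyBelow (momCurve δ (c : ℝ))
    ((affineSpan ℝ (momPts δ (H.erase c)) : AffineSubspace ℝ (Fin δ → ℝ)) : Set (Fin δ → ℝ))

/-- `T` is a triangulation of the cyclic polytope `C(m, δ)`. -/
def IsTriangulation (m δ : ℕ) (T : Finset (Finset ℕ)) : Prop :=
  (∀ S ∈ T, S ⊆ Finset.Icc 1 m ∧ S.card = δ + 1) ∧
  (⋃ S ∈ T, smp δ S) = cyc m δ ∧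
  ∀ S ∈ T, ∀ S' ∈ T, smp δ S ∩ smp δ S' = smp δ (S ∩ S')

/-- `A` is a face of the triangulation `T`. -/
def IsFace (T : Finset (Finset ℕ)) (A : Finset ℕ) : Prop := ∃ S ∈ T, A ⊆ S

/-- `A ≀ B`: writing `A = {a_0 < … < a_d}` and `B = {b_0 < … < b_d}`, we have
`a_0 < b_0 < a_1 < b_1 < … < a_d < b_d`. -/
def Intertwines (d : ℕ) (A B : Finset ℕ) : Prop :=
  ∃ a b : Fin (d + 1) → ℕ, StrictMono a ∧ StrictMono b ∧
    A = Finset.image a Finset.univ ∧ B = Finset.image b Finset.univ ∧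
    (∀ i, a i < b i) ∧ ∀ i : Fin d, b i.castSucc < a i.succ

/-- `y = ℓ_S(x)` is the lift of `x ∈ |S|_δ` to `ℝ^{δ+1}` given by the barycentric
coordinates of `x` with respect to the vertices of `|S|_δ`. -/
def IsLift (δ : ℕ) (S : Finset ℕ) (x : Fin δ → ℝ) (y : Fin (δ + 1) → ℝ) : Prop :=
  ∃ w : ℕ → ℝ, (∀ a ∈ S, 0 ≤ w a) ∧ (∑ a ∈ S, w a) = 1 ∧
    (∑ a ∈ S, w a • momCurve δ (a : ℝ)) = x ∧
    (∑ a ∈ S, w a • momCurve (δ + 1) (a : ℝ)) = y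

/-- `|A|_δ` is submerged by the triangulation `T`. -/
def Submerged (δ : ℕ) (T : Finset (Finset ℕ)) (A : Finset ℕ) : Prop :=
  ∀ S ∈ T, ∀ x ∈ smp δ A ∩ smp δ S, ∀ y y' : Fin (δ + 1) → ℝ,
    IsLift δ A x y → IsLift δ S x y' → lastCoord y ≤ lastCoord y'

/-- `|A|_δ` is supermerged by the triangulation `T`. -/
def Supermerged (δ : ℕ) (T : Finset (Finset ℕ)) (A : Finset ℕ) : Prop :=
  ∀ S ∈ T, ∀ x ∈ smp δ A ∩ smp δ S, ∀ y y' : Fin (δ + 1) → ℝ,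
    IsLift δ A x y → IsLift δ S x y' → lastCoord y' ≤ lastCoord y

/-- The second higher Stasheff–Tamari order `T ≤₂ T'`. -/
def HST2 (δ : ℕ) (T T' : Finset (Finset ℕ)) : Prop :=
  ∀ S ∈ T, ∀ S' ∈ T', ∀ x ∈ smp δ S ∩ smp δ S', ∀ y y' : Fin (δ + 1) → ℝ,
    IsLift δ S x y → IsLift δ S' x y' → lastCoord y ≤ lastCoord y'

open scoped Classical in
/-- The lower triangulation of `C(m, δ)`: the collection of `(δ+1)`-element subsets `F` of
`{1, …, m}` such that `|F|_{δ+1}` is a lower facet of `C(m, δ+1)`. -/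
def lowerTriang (m δ : ℕ) : Finset (Finset ℕ) :=
  (Finset.Icc 1 m).powerset.filter (fun F => IsLowerFacet m (δ + 1) F)

open scoped Classical in
/-- The upper triangulation of `C(m, δ)`. -/
def upperTriang (m δ : ℕ) : Finset (Finset ℕ) :=
  (Finset.Icc 1 m).powerset.filter (fun F => IsUpperFacet m (δ + 1) F)

open scoped Classical in
/-- `L(H)`: the `(δ+1)`-element subsets `G` of `H` with `|G|_{δ+1}` a lower facet of the
simplex `|H|_{δ+1}`. -/
def LH (δ : ℕ) (H : Finset ℕ) : Finset (Finset ℕ) :=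
  (H.filter (fun c => IsLowerFacetOfSimplex (δ + 1) H c)).image (fun c => H.erase c)

open scoped Classical in
/-- `U(H)`: the `(δ+1)`-element subsets `G` of `H` with `|G|_{δ+1}` an upper facet of the
simplex `|H|_{δ+1}`. -/
def UH (δ : ℕ) (H : Finset ℕ) : Finset (Finset ℕ) :=
  (H.filter (fun c => IsUpperFacetOfSimplex (δ + 1) H c)).image (fun c => H.erase c)

open Polynomial in
/-- The affine functional on `ℝ^δ` whose restriction to the moment curve is the polynomial `P`. -/
def momFunctional (δ : ℕ) (P : ℝ[X]) (x : Fin δ → ℝ) : ℝ :=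
  P.coeff 0 + ∑ i : Fin δ, P.coeff (i.1 + 1) * x i

/-- `w` is an affine dependence of the points `p_δ(a)`, `a ∈ K`. -/
def IsAffDep (δ : ℕ) (K : Finset ℕ) (w : ℕ → ℝ) : Prop :=
  ∑ a ∈ K, w a = 0 ∧ ∑ a ∈ K, w a • momCurve δ (a : ℝ) = 0

lemma injOn_natCast (s : Set ℕ) : Set.InjOn (fun a : ℕ => (a : ℝ)) s :=
  Nat.cast_injective.injOn

open Polynomial in
lemma momFunctional_momCurve {δ : ℕ} {P : ℝ[X]} (hP : P.natDegree ≤ δ) (t : ℝ) :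
    momFunctional δ P (momCurve δ t) = P.eval t := by
  rw [eval_eq_sum_range' (Nat.lt_succ_of_le hP), Finset.sum_range_succ', momFunctional, add_comm,
    Finset.sum_range]
  simp [momCurve]

open Polynomial in
lemma momFunctional_sum {δ : ℕ} {P : ℝ[X]} (hP : P.natDegree ≤ δ) (K : Finset ℕ) (w : ℕ → ℝ)
    (hw : ∑ a ∈ K, w a = 1) :
    momFunctional δ P (∑ a ∈ K, w a • momCurve δ (a : ℝ)) = ∑ a ∈ K, w a * P.eval (a : ℝ) := by
  simp_rw [← momFunctional_momCurve hP, momFunctional, mul_add, Finset.sum_add_distrib,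
    ← Finset.sum_mul, hw, one_mul, Finset.sum_apply, Finset.mul_sum]
  rw [Finset.sum_comm]
  simp only [Pi.smul_apply, smul_eq_mul]
  congr 1
  exact Finset.sum_congr rfl fun _ _ => Finset.sum_congr rfl fun _ _ => by ring

open Polynomial in
lemma IsAffDep.sum_eval {δ : ℕ} {K : Finset ℕ} {w : ℕ → ℝ} (h : IsAffDep δ K w) {P : ℝ[X]}
    (hP : P.natDegree ≤ δ) : ∑ a ∈ K, w a * P.eval (a : ℝ) = 0 := by
  have h2 : ∀ i : Fin δ, ∑ a ∈ K, w a * momCurve δ (a : ℝ) i = 0 := fun i => by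
    simpa using congrFun h.2 i
  simp_rw [← momFunctional_momCurve hP, momFunctional, mul_add, Finset.sum_add_distrib,
    ← Finset.sum_mul, h.1, zero_mul, zero_add, Finset.mul_sum]
  rw [Finset.sum_comm]
  refine Finset.sum_eq_zero fun i _ => ?_
  calc _ = P.coeff (i.1 + 1) * ∑ a ∈ K, w a * momCurve δ (a : ℝ) i := by
        rw [Finset.mul_sum]; exact Finset.sum_congr rfl fun _ _ => by ring
    _ = 0 := by rw [h2, mul_zero]

/-- At most `δ + 1` points on the moment curve are affinely independent. -/
lemma IsAffDep.eq_zero {δ : ℕ} {K : Finset ℕ} {w : ℕ → ℝ} (h : IsAffDep δ K w)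
    (hK : K.card ≤ δ + 1) {c : ℕ} (hc : c ∈ K) : w c = 0 := by
  have hdeg : (Lagrange.nodal (K.erase c) (fun a : ℕ => (a : ℝ))).natDegree ≤ δ := by
    rw [Lagrange.natDegree_nodal, Finset.card_erase_of_mem hc]; omega
  have := h.sum_eval hdeg
  rw [Finset.sum_eq_single_of_mem c hc fun b hb hbc => by
    rw [Lagrange.eval_nodal_at_node (v := fun a : ℕ => (a : ℝ))
      (Finset.mem_erase.2 ⟨hbc, hb⟩), mul_zero]] at this
  refine (mul_eq_zero.1 this).resolve_right ?_
  rw [Lagrange.eval_nodal]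
  refine Finset.prod_ne_zero_iff.2 fun b hb => ?_
  exact sub_ne_zero.2 fun e => (Finset.mem_erase.1 hb).1 (Nat.cast_injective e).symm

lemma IsAffDep.mono {δ : ℕ} {K K' : Finset ℕ} {w : ℕ → ℝ} (h : IsAffDep δ K w) (hKK : K' ⊆ K)
    (hw : ∀ a ∈ K, a ∉ K' → w a = 0) : IsAffDep δ K' w :=
  ⟨(Finset.sum_subset hKK hw).trans h.1,
    (Finset.sum_subset hKK fun a ha ha' => by rw [hw a ha ha', zero_smul]).trans h.2⟩

/-- The barycentric weights form an affine dependence of `δ + 2` points on the moment curve. -/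
lemma isAffDep_inv_prod {δ : ℕ} {H : Finset ℕ} (hH : H.card = δ + 2) :
    IsAffDep δ H fun c => (∏ j ∈ H.erase c, ((c : ℝ) - j))⁻¹ := by
  have key : ∀ k ≤ δ, ∑ c ∈ H, (∏ j ∈ H.erase c, ((c : ℝ) - j))⁻¹ * (c : ℝ) ^ k = 0 := by
    intro k hk
    have hdeg : (Polynomial.X ^ k : Polynomial ℝ).degree < (H.card : ℕ) := by
      rw [Polynomial.degree_X_pow, hH]; exact_mod_cast (by omega)
    have := Lagrange.coeff_eq_sum (injOn_natCast H) hdeg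
    rw [Polynomial.coeff_X_pow, if_neg (by omega)] at this
    rw [this]
    exact Finset.sum_congr rfl fun c _ => by simp [div_eq_inv_mul]
  refine ⟨by simpa using key 0 (Nat.zero_le _), ?_⟩
  ext i
  simpa [momCurve] using key (i.1 + 1) i.2

/-- Any `δ + 1` or more points on the moment curve affinely span `ℝ^δ`. -/
lemma exists_affine_combination {δ : ℕ} {H : Finset ℕ} (hH : δ + 1 ≤ H.card) (S : Finset ℕ)
    (v : ℕ → ℝ) : ∃ c : ℕ → ℝ, ∑ a ∈ H, c a = ∑ a ∈ S, v a ∧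
      ∑ a ∈ H, c a • momCurve δ (a : ℝ) = ∑ a ∈ S, v a • momCurve δ (a : ℝ) := by
  let L (a : ℕ) := Lagrange.basis H (fun a : ℕ => (a : ℝ)) a
  have key : ∀ k ≤ δ, ∑ c ∈ H, (∑ s ∈ S, v s * (L c).eval (s : ℝ)) * (c : ℝ) ^ k
      = ∑ s ∈ S, v s * (s : ℝ) ^ k := by
    intro k hk
    have hdeg : (Polynomial.X ^ k : Polynomial ℝ).degree < (H.card : ℕ) := by
      rw [Polynomial.degree_X_pow]; exact_mod_cast (by omega)
    have hX := Lagrange.eq_interpolate (injOn_natCast H) hdeg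
    have hX' : ∀ s : ℝ, s ^ k = ∑ c ∈ H, (c : ℝ) ^ k * (L c).eval s := fun s => by
      have := congrArg (Polynomial.eval s) hX
      simpa [Lagrange.interpolate_apply, Polynomial.eval_finsetSum] using this
    simp_rw [Finset.sum_mul]
    rw [Finset.sum_comm]
    refine Finset.sum_congr rfl fun s _ => ?_
    rw [hX' s, Finset.mul_sum]
    exact Finset.sum_congr rfl fun c _ => by ring
  refine ⟨fun c => ∑ s ∈ S, v s * (L c).eval (s : ℝ), by simpa using key 0 (Nat.zero_le _), ?_⟩
  ext i
  simpa [momCurve] using key (i.1 + 1) i.2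

lemma mem_smp_iff {δ : ℕ} {G : Finset ℕ} {x : Fin δ → ℝ} :
    x ∈ smp δ G ↔ ∃ w : ℕ → ℝ, (∀ a, 0 ≤ w a) ∧ (∀ a ∉ G, w a = 0) ∧ ∑ a ∈ G, w a = 1 ∧
      ∑ a ∈ G, w a • momCurve δ (a : ℝ) = x := by
  constructor
  · intro hx
    obtain ⟨ι, _, w, z, hw0, hw1, hz, rfl⟩ := mem_convexHull_iff_exists_fintype.1 hx
    choose f hfG hf using hz
    refine ⟨fun a => ∑ i with f i = a, w i, fun a => Finset.sum_nonneg fun i _ => hw0 i,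
      fun a ha => Finset.sum_eq_zero fun i hi => ?_, ?_, ?_⟩
    · exact absurd ((Finset.mem_filter.1 hi).2 ▸ hfG i) ha
    · rw [Finset.sum_fiberwise_of_maps_to (fun i _ => hfG i), hw1]
    · simp_rw [Finset.sum_smul]
      rw [← Finset.sum_fiberwise_of_maps_to (fun i _ => hfG i)]
      refine Finset.sum_congr rfl fun a _ => Finset.sum_congr rfl fun i hi => ?_
      rw [← hf i, (Finset.mem_filter.1 hi).2]
  · rintro ⟨w, hw0, -, hw1, rfl⟩
    exact (convex_convexHull ℝ _).sum_mem (fun a _ => hw0 a) hw1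
      fun a ha => subset_convexHull ℝ _ ⟨a, ha, rfl⟩

lemma smp_mono {δ : ℕ} {G K : Finset ℕ} (h : G ⊆ K) : smp δ G ⊆ smp δ K :=
  convexHull_mono (Set.image_mono h)

/-- Two convex combinations of the same point over subsets of `K` differ by a dependence. -/
lemma isAffDep_sub {δ : ℕ} {G G' K : Finset ℕ} (hG : G ⊆ K) (hG' : G' ⊆ K) {w w' : ℕ → ℝ}
    (hw : ∀ a ∉ G, w a = 0) (hw' : ∀ a ∉ G', w' a = 0)
    (h1 : ∑ a ∈ G, w a = ∑ a ∈ G', w' a)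
    (h2 : ∑ a ∈ G, w a • momCurve δ (a : ℝ) = ∑ a ∈ G', w' a • momCurve δ (a : ℝ)) :
    IsAffDep δ K fun a => w a - w' a := by
  constructor
  · rw [Finset.sum_sub_distrib, ← Finset.sum_subset hG fun a _ ha => hw a ha,
      ← Finset.sum_subset hG' fun a _ ha => hw' a ha, h1, sub_self]
  · simp_rw [sub_smul]
    rw [Finset.sum_sub_distrib,
      ← Finset.sum_subset hG fun a _ ha => by rw [hw a ha, zero_smul],
      ← Finset.sum_subset hG' fun a _ ha => by rw [hw' a ha, zero_smul], h2, sub_self]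

section Circuit

variable {δ : ℕ} {H : Finset ℕ} {l : ℕ → ℝ}

lemma IsAffDep.neg (h : IsAffDep δ H l) : IsAffDep δ H fun a => -l a := by
  refine ⟨by rw [Finset.sum_neg_distrib, h.1, neg_zero], ?_⟩
  simp_rw [neg_smul]
  rw [Finset.sum_neg_distrib, h.2, neg_zero]

/-- The simplices missing a positive vertex of a circuit cover its convex hull. -/
lemma exists_mem_smp_erase (hl : IsAffDep δ H l) {b₀ : ℕ} (hb₀ : b₀ ∈ H) (hlb₀ : 0 < l b₀)
    {x : Fin δ → ℝ} (hx : x ∈ smp δ H) : ∃ b ∈ H, 0 < l b ∧ x ∈ smp δ (H.erase b) := by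
  obtain ⟨w, hw0, hwH, hw1, rfl⟩ := mem_smp_iff.1 hx
  obtain ⟨b, hb, hmin⟩ := Finset.exists_min_image (H.filter fun a => 0 < l a)
    (fun a => w a / l a) ⟨b₀, Finset.mem_filter.2 ⟨hb₀, hlb₀⟩⟩
  obtain ⟨hbH, hlb⟩ := Finset.mem_filter.1 hb
  set t := w b / l b with ht
  have ht0 : 0 ≤ t := div_nonneg (hw0 b) hlb.le
  have hb0 : w b - t * l b = 0 := by rw [ht, div_mul_cancel₀ _ hlb.ne', sub_self]
  have hsum1 : ∑ a ∈ H, (w a - t * l a) = 1 := by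
    rw [Finset.sum_sub_distrib, ← Finset.mul_sum, hl.1, hw1]; ring
  have hsum2 : ∑ a ∈ H, (w a - t * l a) • momCurve δ (a : ℝ)
      = ∑ a ∈ H, w a • momCurve δ (a : ℝ) := by
    simp_rw [sub_smul, mul_smul]
    rw [Finset.sum_sub_distrib, ← Finset.smul_sum, hl.2, smul_zero, sub_zero]
  refine ⟨b, hbH, hlb, ?_⟩
  rw [← hsum2, ← Finset.add_sum_erase H _ hbH, hb0, zero_smul, zero_add]
  refine (convex_convexHull ℝ _).sum_mem (fun a ha => ?_) ?_
    fun a ha => subset_convexHull ℝ _ ⟨a, ha, rfl⟩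
  · have haH := Finset.mem_of_mem_erase ha
    rcases lt_or_ge 0 (l a) with h | h
    · have := hmin a (Finset.mem_filter.2 ⟨haH, h⟩)
      rw [le_div_iff₀ h] at this
      linarith
    · have := hw0 a
      nlinarith
  · rw [← Finset.add_sum_erase H _ hbH, hb0, zero_add] at hsum1
    exact hsum1

/-- Faces of a circuit missing a positive vertex intersect properly. -/
lemma smp_inter_of_circuit (hH : H.card = δ + 2) (hl : IsAffDep δ H l) {G G' : Finset ℕ}
    (hG : G ⊆ H) (hG' : G' ⊆ H) {b b' : ℕ} (hbH : b ∈ H) (hb : 0 < l b) (hbG : b ∉ G)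
    (hbH' : b' ∈ H) (hb' : 0 < l b') (hbG' : b' ∉ G') :
    smp δ G ∩ smp δ G' = smp δ (G ∩ G') := by
  refine Set.Subset.antisymm ?_ (Set.subset_inter (smp_mono Finset.inter_subset_left)
    (smp_mono Finset.inter_subset_right))
  rintro x ⟨hx, hx'⟩
  obtain ⟨w, hw0, hwG, hw1, hwx⟩ := mem_smp_iff.1 hx
  obtain ⟨w', hw0', hwG', hw1', hwx'⟩ := mem_smp_iff.1 hx'
  have hdep := isAffDep_sub hG hG' hwG hwG' (hw1.trans hw1'.symm) (hwx.trans hwx'.symm)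
  set t := (w b - w' b) / l b with ht
  have hdep' : IsAffDep δ H fun a => w a - w' a - t * l a := by
    constructor
    · rw [Finset.sum_sub_distrib, hdep.1, ← Finset.mul_sum, hl.1]; ring
    · simp_rw [sub_smul _ (t * _), mul_smul]
      rw [Finset.sum_sub_distrib, hdep.2, ← Finset.smul_sum, hl.2]; simp
  have hbz : w b - w' b - t * l b = 0 := by rw [ht, div_mul_cancel₀ _ hb.ne', sub_self]
  have hz : ∀ a ∈ H, w a - w' a - t * l a = 0 := by
    intro a ha
    by_cases hab : a = b
    · rw [hab, hbz]
    · refine (hdep'.mono (Finset.erase_subset b H) fun c hc hc' => ?_).eq_zero ?_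
        (Finset.mem_erase.2 ⟨hab, ha⟩)
      · have : c = b := by simpa [hc] using hc'
        rw [this, hbz]
      · rw [Finset.card_erase_of_mem hbH]; omega
  have ht_le : t ≤ 0 := by
    have h1 := hwG b hbG
    have h2 := hw0' b
    by_contra! h
    nlinarith
  have ht_ge : 0 ≤ t := by
    have h1 := hwG' b' hbG'
    have h2 := hw0 b'
    have h3 := hz b' hbH'
    by_contra! h
    nlinarith
  have ht0 : t = 0 := le_antisymm ht_le ht_ge
  have hww : ∀ a ∈ H, w a = w' a := fun a ha => by
    have := hz a ha
    rw [ht0] at this; linarith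
  have hsupp : ∀ a ∈ G, a ∉ G ∩ G' → w a = 0 := fun a ha ha' => by
    rw [hww a (hG ha)]; exact hwG' a fun h => ha' (Finset.mem_inter.2 ⟨ha, h⟩)
  refine mem_smp_iff.2 ⟨w, hw0, fun a ha => ?_, ?_, ?_⟩
  · by_cases h : a ∈ G
    · exact hsupp a h ha
    · exact hwG a h
  · rw [Finset.sum_subset Finset.inter_subset_left hsupp, hw1]
  · rw [Finset.sum_subset Finset.inter_subset_left fun a ha ha' => by
      rw [hsupp a ha ha', zero_smul], hwx]

end Circuit

/-- A simplex of a triangulation containing all negative vertices of a circuit, all of whose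
simplices missing a positive vertex belong to the triangulation, is one of the latter. -/
lemma eq_erase_of_negative_subset {m δ : ℕ} {T : Finset (Finset ℕ)} (hT : IsTriangulation m δ T)
    {H : Finset ℕ} {l : ℕ → ℝ} (hH : H.card = δ + 2) (hl : IsAffDep δ H l)
    (hl0 : ∀ a ∈ H, l a ≠ 0) (hpos : ∃ b ∈ H, 0 < l b)
    (hL : ∀ b ∈ H, 0 < l b → H.erase b ∈ T) {S : Finset ℕ} (hS : S ∈ T)
    (hAS : ∀ a ∈ H, l a < 0 → a ∈ S) : ∃ b ∈ H, 0 < l b ∧ S = H.erase b := by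
  obtain ⟨b₀, hb₀, hlb₀⟩ := hpos
  have hScard := (hT.1 S hS).2
  obtain ⟨c, hc1, hc2⟩ := exists_affine_combination (δ := δ) (H := H) (by omega) S fun _ => 1
  set N : ℝ := ∑ a ∈ H, 2 * |c a| / |l a| with hN
  have hN0 : 0 ≤ N := Finset.sum_nonneg fun a _ => by positivity
  have hU : ∀ a ∈ H, 0 ≤ N * (|l a| / 2) + c a := by
    intro a ha
    have h1 : 2 * |c a| / |l a| ≤ N :=
      Finset.single_le_sum (f := fun a => 2 * |c a| / |l a|) (fun a _ => by positivity) ha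
    rw [div_le_iff₀ (abs_pos.2 (hl0 a ha))] at h1
    have := neg_abs_le (c a)
    linarith
  let n : ℕ → ℝ := fun a => if a ∈ H then (|l a| - l a) / 2 else 0
  have hn0 : ∀ a, 0 ≤ n a := fun a => by
    by_cases ha : a ∈ H
    · simp only [n, if_pos ha]; linarith [le_abs_self (l a)]
    · simp [n, ha]
  have hnS : ∀ a ∉ S, n a = 0 := fun a ha => by
    by_cases haH : a ∈ H
    · have : 0 ≤ l a := not_lt.1 fun h => ha (hAS a haH h)
      simp [n, abs_of_nonneg this]
    · simp [n, haH]
  have hswap : ∀ {M : Type} [AddCommGroup M] [Module ℝ M] (p : ℕ → M),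
      ∑ a ∈ H, l a • p a = 0 → ∑ a ∈ S, n a • p a = ∑ a ∈ H, (|l a| / 2) • p a := by
    intro M _ _ p hp
    have h1 : ∑ a ∈ S, n a • p a = ∑ a ∈ H, n a • p a := by
      exact (Finset.sum_subset (Finset.subset_union_left (s₂ := H)) fun a _ ha => by
        rw [hnS a ha, zero_smul]).trans
        (Finset.sum_subset (Finset.subset_union_right (s₁ := S)) fun a _ ha => by
          simp [n, ha]).symm
    have h2 : ∑ a ∈ H, n a • p a
        = ∑ a ∈ H, (|l a| / 2) • p a - (1 / 2 : ℝ) • ∑ a ∈ H, l a • p a := by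
      rw [Finset.smul_sum, ← Finset.sum_sub_distrib]
      refine Finset.sum_congr rfl fun a ha => ?_
      simp only [n, if_pos ha]
      rw [smul_smul, ← sub_smul]
      congr 1; ring
    rw [h1, h2, hp, smul_zero, sub_zero]
  have hswap1 : ∑ a ∈ S, n a = ∑ a ∈ H, |l a| / 2 := by
    simpa using hswap (M := ℝ) (fun _ => 1) (by simpa using hl.1)
  have hswap2 := hswap _ hl.2
  have hV : ∀ a, 0 < N * n a + 1 := fun a => by
    have := mul_nonneg hN0 (hn0 a); linarith
  set M : ℝ := ∑ a ∈ S, (N * n a + 1) with hM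
  have hSne : S.Nonempty := Finset.card_pos.1 (by omega)
  have hM0 : 0 < M := Finset.sum_pos (fun a _ => hV a) hSne
  have hMH : ∑ a ∈ H, (N * (|l a| / 2) + c a) = M := by
    rw [hM, Finset.sum_add_distrib, Finset.sum_add_distrib, ← Finset.mul_sum, ← Finset.mul_sum,
      hc1, hswap1]
  have hpt : ∑ a ∈ H, (N * (|l a| / 2) + c a) • momCurve δ (a : ℝ)
      = ∑ a ∈ S, (N * n a + 1) • momCurve δ (a : ℝ) := by
    simp_rw [add_smul, mul_smul, Finset.sum_add_distrib]
    rw [← Finset.smul_sum, ← Finset.smul_sum, hc2, hswap2]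
  set x : Fin δ → ℝ := ∑ a ∈ S, ((N * n a + 1) / M) • momCurve δ (a : ℝ) with hx
  have hxH : x ∈ smp δ H := by
    have : x = ∑ a ∈ H, ((N * (|l a| / 2) + c a) / M) • momCurve δ (a : ℝ) := by
      simp_rw [hx, div_eq_inv_mul _ M, mul_smul]
      rw [← Finset.smul_sum, ← Finset.smul_sum, hpt]
    rw [this]
    refine (convex_convexHull ℝ _).sum_mem (fun a ha => div_nonneg (hU a ha) hM0.le) ?_
      fun a ha => subset_convexHull ℝ _ ⟨a, ha, rfl⟩
    rw [← Finset.sum_div, hMH, div_self hM0.ne']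
  have hsum1 : ∑ a ∈ S, (N * n a + 1) / M = 1 := by rw [← Finset.sum_div, div_self hM0.ne']
  have hxS : x ∈ smp δ S :=
    (convex_convexHull ℝ _).sum_mem (fun a _ => (div_pos (hV a) hM0).le) hsum1
      fun a ha => subset_convexHull ℝ _ ⟨a, ha, rfl⟩
  obtain ⟨b, hbH, hb, hxb⟩ := exists_mem_smp_erase hl hb₀ hlb₀ hxH
  have hxI : x ∈ smp δ (S ∩ H.erase b) := hT.2.2 S hS _ (hL b hbH hb) ▸ ⟨hxS, hxb⟩
  obtain ⟨w, -, hwI, hw1, hwx⟩ := mem_smp_iff.1 hxI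
  have hdep : IsAffDep δ S fun a => (if a ∈ S then (N * n a + 1) / M else 0) - w a := by
    refine isAffDep_sub subset_rfl Finset.inter_subset_left (fun a ha => if_neg ha) hwI ?_ ?_
    · exact (Finset.sum_congr rfl fun a ha => if_pos ha).trans (hsum1.trans hw1.symm)
    · rw [hwx, hx]
      exact Finset.sum_congr rfl fun a ha => by rw [if_pos ha]
  refine ⟨b, hbH, hb, Finset.eq_of_subset_of_card_le (fun a ha => ?_) ?_⟩
  · by_contra hab
    have h1 := hdep.eq_zero hScard.le ha
    rw [if_pos ha, hwI a fun h => hab (Finset.mem_inter.1 h).2, sub_zero] at h1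
    exact (div_pos (hV a) hM0).ne' h1
  · rw [Finset.card_erase_of_mem hbH]; omega

/-- A bistellar flip of a triangulation of a cyclic polytope is a triangulation. -/
lemma IsTriangulation.flip {m δ : ℕ} {T L U : Finset (Finset ℕ)} (hT : IsTriangulation m δ T)
    {H : Finset ℕ} (hHm : H ⊆ Finset.Icc 1 m) {l : ℕ → ℝ} (hH : H.card = δ + 2)
    (hl : IsAffDep δ H l) (hl0 : ∀ a ∈ H, l a ≠ 0) (hpos : ∃ b ∈ H, 0 < l b)
    (hneg : ∃ a ∈ H, l a < 0) (hL : ∀ G, G ∈ L ↔ ∃ b ∈ H, 0 < l b ∧ G = H.erase b)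
    (hU : ∀ G, G ∈ U ↔ ∃ a ∈ H, l a < 0 ∧ G = H.erase a) (hLT : L ⊆ T) :
    IsTriangulation m δ ((T \ L) ∪ U) := by
  have hcoverL : ⋃ S ∈ L, smp δ S = smp δ H := by
    refine Set.Subset.antisymm (Set.iUnion₂_subset fun S hS => ?_) fun x hx => ?_
    · obtain ⟨b, -, -, rfl⟩ := (hL S).1 hS
      exact smp_mono (Finset.erase_subset _ _)
    · obtain ⟨b₀, hb₀, hlb₀⟩ := hpos
      obtain ⟨b, hbH, hb, hxb⟩ := exists_mem_smp_erase hl hb₀ hlb₀ hx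
      exact Set.mem_biUnion ((hL _).2 ⟨b, hbH, hb, rfl⟩) hxb
  have hcoverU : ⋃ S ∈ U, smp δ S = smp δ H := by
    refine Set.Subset.antisymm (Set.iUnion₂_subset fun S hS => ?_) fun x hx => ?_
    · obtain ⟨b, -, -, rfl⟩ := (hU S).1 hS
      exact smp_mono (Finset.erase_subset _ _)
    · obtain ⟨b₀, hb₀, hlb₀⟩ := hneg
      obtain ⟨b, hbH, hb, hxb⟩ := exists_mem_smp_erase hl.neg hb₀ (neg_pos.2 hlb₀) hx
      exact Set.mem_biUnion ((hU _).2 ⟨b, hbH, neg_pos.1 hb, rfl⟩) hxb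
  have hUU : ∀ S ⊆ H, ∀ a ∈ H, l a < 0 → a ∉ S → ∀ S' ∈ U,
      smp δ S ∩ smp δ S' = smp δ (S ∩ S') := by
    intro S hS a ha hla haS S' hS'
    obtain ⟨a', ha', hla', rfl⟩ := (hU S').1 hS'
    exact smp_inter_of_circuit hH hl.neg hS (Finset.erase_subset _ _) ha (neg_pos.2 hla) haS
      ha' (neg_pos.2 hla') (Finset.notMem_erase _ _)
  have hTU : ∀ S ∈ T \ L, ∀ S' ∈ U, smp δ S ∩ smp δ S' = smp δ (S ∩ S') := by
    intro S hS S' hS'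
    obtain ⟨hST, hSL⟩ := Finset.mem_sdiff.1 hS
    refine Set.Subset.antisymm ?_ (Set.subset_inter (smp_mono Finset.inter_subset_left)
      (smp_mono Finset.inter_subset_right))
    rintro x ⟨hx, hx'⟩
    have hxH : x ∈ ⋃ S ∈ L, smp δ S := by
      rw [hcoverL, ← hcoverU]
      exact Set.mem_biUnion hS' hx'
    obtain ⟨G, hG, hxG⟩ := Set.mem_iUnion₂.1 hxH
    have hxSG : x ∈ smp δ (S ∩ G) := hT.2.2 S hST G (hLT hG) ▸ ⟨hx, hxG⟩
    obtain ⟨a, haH, hla, haS⟩ : ∃ a ∈ H, l a < 0 ∧ a ∉ S := by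
      by_contra! hcon
      refine hSL ((hL S).2 (eq_erase_of_negative_subset hT hH hl hl0 hpos
        (fun b hb hlb => hLT ((hL _).2 ⟨b, hb, hlb, rfl⟩)) hST hcon))
    have hGH : G ⊆ H := by
      obtain ⟨b, -, -, rfl⟩ := (hL G).1 hG
      exact Finset.erase_subset _ _
    have hxI : x ∈ smp δ ((S ∩ G) ∩ S') :=
      hUU (S ∩ G) (Finset.inter_subset_right.trans hGH) a haH hla
        (fun h => haS (Finset.mem_inter.1 h).1) S' hS' ▸ ⟨hxSG, hx'⟩
    exact smp_mono (Finset.inter_subset_inter_right Finset.inter_subset_left) hxI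
  refine ⟨fun S hS => ?_, ?_, fun S hS S' hS' => ?_⟩
  · rcases Finset.mem_union.1 hS with hS | hS
    · exact hT.1 S (Finset.mem_sdiff.1 hS).1
    · obtain ⟨a, ha, -, rfl⟩ := (hU S).1 hS
      exact ⟨(Finset.erase_subset _ _).trans hHm, by rw [Finset.card_erase_of_mem ha]; omega⟩
  · rw [← hT.2.1, Finset.set_biUnion_union, hcoverU, ← hcoverL, ← Finset.set_biUnion_union,
      Finset.sdiff_union_of_subset hLT]
  · rcases Finset.mem_union.1 hS with hS | hS <;> rcases Finset.mem_union.1 hS' with hS' | hS'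
    · exact hT.2.2 S (Finset.mem_sdiff.1 hS).1 S' (Finset.mem_sdiff.1 hS').1
    · exact hTU S hS S' hS'
    · rw [Set.inter_comm, Finset.inter_comm]
      exact hTU S' hS' S hS
    · obtain ⟨a, ha, hla, rfl⟩ := (hU S).1 hS
      exact hUU _ (Finset.erase_subset _ _) a ha hla (Finset.notMem_erase _ _) S' hS'

lemma momFunctional_affine {δ : ℕ} (P : Polynomial ℝ) (c : ℝ) (u v w : Fin δ → ℝ) :
    momFunctional δ P (c • (u - v) + w)
      = c * (momFunctional δ P u - momFunctional δ P v) + momFunctional δ P w := by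
  simp only [momFunctional, Pi.add_apply, Pi.smul_apply, Pi.sub_apply, smul_eq_mul, mul_add,
    mul_sub, Finset.sum_add_distrib, Finset.sum_sub_distrib, Finset.mul_sum]
  simp_rw [mul_left_comm]
  ring

/-- The signed height of `p_n(t)` over the hyperplane spanned by `n` points of the moment curve. -/
lemma eq_prod_of_sub_smul_mem {n : ℕ} (hn : 1 ≤ n) {F : Finset ℕ} (hF : F.card = n) {t r : ℝ}
    (h : momCurve n t - r • eLast n ∈ affineSpan ℝ (momPts n F)) :
    r = ∏ f ∈ F, (t - f) := by
  set P := Lagrange.nodal F (fun a : ℕ => (a : ℝ)) with hP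
  have hdeg : P.natDegree = n := by rw [hP, Lagrange.natDegree_nodal, hF]
  have hzero : ∀ x ∈ affineSpan ℝ (momPts n F), momFunctional n P x = 0 := by
    intro x hx
    refine affineSpan_induction hx ?_ fun c u v w hu hv hw => ?_
    · rintro _ ⟨a, ha, rfl⟩
      simp only
      rw [momFunctional_momCurve hdeg.le]
      exact Lagrange.eval_nodal_at_node (v := fun a : ℕ => (a : ℝ)) ha
    · rw [vsub_eq_sub, vadd_eq_add, momFunctional_affine, hu, hv, hw]; ring
  have hlast : momFunctional n P (momCurve n t - r • eLast n)
      = momFunctional n P (momCurve n t) - r := by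
    have hlead : P.coeff n = 1 := by
      have := (Lagrange.nodal_monic (s := F) (v := fun a : ℕ => (a : ℝ))).coeff_natDegree
      rwa [← hP, hdeg] at this
    have hsum : ∑ i : Fin n, P.coeff (i.1 + 1) * (r * eLast n i) = r := by
      rw [Finset.sum_eq_single_of_mem (⟨n - 1, by omega⟩ : Fin n) (Finset.mem_univ _)]
      · simp [eLast, Nat.sub_add_cancel hn, hlead]
      · intro i _ hi
        have : i.1 ≠ n - 1 := fun e => hi (Fin.ext e)
        simp [eLast, this]
    simp only [momFunctional, Pi.sub_apply, Pi.smul_apply, smul_eq_mul, mul_sub,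
      Finset.sum_sub_distrib, hsum]
    ring
  have h0 := hzero _ h
  rw [hlast, momFunctional_momCurve hdeg.le, hP, Lagrange.eval_nodal] at h0
  linarith

lemma sub_prod_smul_mem {δ : ℕ} {F : Finset ℕ} (hF : F.card = δ + 1) (t : ℕ) :
    momCurve (δ + 1) (t : ℝ) - (∏ f ∈ F, ((t : ℝ) - f)) • eLast (δ + 1)
      ∈ affineSpan ℝ (momPts (δ + 1) F) := by
  obtain ⟨c, hc1, hc2⟩ := exists_affine_combination (δ := δ) hF.ge {t} fun _ => 1
  rw [Finset.sum_singleton] at hc1 hc2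
  have hmem : ∑ a ∈ F, c a • momCurve (δ + 1) (a : ℝ) ∈ affineSpan ℝ (momPts (δ + 1) F) := by
    rw [← Finset.affineCombination_eq_linear_combination F _ c hc1]
    exact affineCombination_mem_affineSpan_image hc1 (fun i hi h => absurd hi h) _
  have hz : ∑ a ∈ F, c a • momCurve (δ + 1) (a : ℝ) = momCurve (δ + 1) (t : ℝ)
      - ((t : ℝ) ^ (δ + 1) - ∑ a ∈ F, c a * (a : ℝ) ^ (δ + 1)) • eLast (δ + 1) := by
    ext i
    by_cases hi : i.1 = δ
    · simp [momCurve, eLast, hi]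
    · have := congrFun hc2 ⟨i.1, by omega⟩
      simp only [Finset.sum_apply, Pi.smul_apply, smul_eq_mul, momCurve, one_mul] at this
      simpa [momCurve, eLast, hi] using this
  have hr := eq_prod_of_sub_smul_mem (by omega) hF (hz ▸ hmem)
  rwa [hz, hr] at hmem

lemma isLowerFacetOfSimplex_iff {δ : ℕ} {H : Finset ℕ} (hH : H.card = δ + 2) (c : ℕ) :
    IsLowerFacetOfSimplex (δ + 1) H c ↔ c ∈ H ∧ 0 < ∏ j ∈ H.erase c, ((c : ℝ) - j) := by
  refine and_congr_right fun hc => ?_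
  have hcard : (H.erase c).card = δ + 1 := by rw [Finset.card_erase_of_mem hc]; omega
  constructor
  · rintro ⟨r, hr, hmem⟩
    rwa [← eq_prod_of_sub_smul_mem (by omega) hcard hmem]
  · exact fun hpos => ⟨_, hpos, sub_prod_smul_mem hcard c⟩

lemma isUpperFacetOfSimplex_iff {δ : ℕ} {H : Finset ℕ} (hH : H.card = δ + 2) (c : ℕ) :
    IsUpperFacetOfSimplex (δ + 1) H c ↔ c ∈ H ∧ ∏ j ∈ H.erase c, ((c : ℝ) - j) < 0 := by
  refine and_congr_right fun hc => ?_
  have hcard : (H.erase c).card = δ + 1 := by rw [Finset.card_erase_of_mem hc]; omega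
  constructor
  · rintro ⟨r, hr, hmem⟩
    rwa [← eq_prod_of_sub_smul_mem (by omega) hcard hmem]
  · exact fun hneg => ⟨_, hneg, sub_prod_smul_mem hcard c⟩

/-- The positive part of a circuit is contained in no lower facet. -/
lemma not_smp_subset_lowerFacet {m δ : ℕ} (hδ : 1 ≤ δ) {H : Finset ℕ}
    (hHm : H ⊆ Finset.Icc 1 m) {l : ℕ → ℝ} (hH : H.card = δ + 2) (hl : IsAffDep δ H l)
    (hl0 : ∀ a ∈ H, l a ≠ 0) {B : Finset ℕ} (hB : ∀ b, b ∈ B ↔ b ∈ H ∧ 0 < l b)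
    {F : Finset ℕ} (hF : IsLowerFacet m δ F) : ¬ smp δ B ⊆ smp δ F := by
  intro hsub
  set P := Lagrange.nodal F (fun a : ℕ => (a : ℝ)) with hP
  have hdeg : P.natDegree ≤ δ := by rw [hP, Lagrange.natDegree_nodal, hF.2.1]
  have hPF : ∀ a ∈ F, P.eval (a : ℝ) = 0 := fun a ha =>
    Lagrange.eval_nodal_at_node (v := fun a : ℕ => (a : ℝ)) ha
  have hPpos : ∀ a ∈ H, a ∉ F → 0 < P.eval (a : ℝ) := fun a ha haF => by
    obtain ⟨r, hr, hmem⟩ := hF.2.2 a (hHm ha) haF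
    rw [hP, Lagrange.eval_nodal, ← eq_prod_of_sub_smul_mem hδ hF.2.1 hmem]
    exact hr
  have hzero : ∀ b ∈ B, P.eval (b : ℝ) = 0 := by
    intro b hb
    have hx : momCurve δ (b : ℝ) ∈ smp δ F := hsub (subset_convexHull ℝ _ ⟨b, hb, rfl⟩)
    obtain ⟨w, -, -, hw1, hwx⟩ := mem_smp_iff.1 hx
    rw [← momFunctional_momCurve hdeg, ← hwx, momFunctional_sum hdeg _ _ hw1]
    exact Finset.sum_eq_zero fun a ha => by rw [hPF a ha, mul_zero]
  obtain ⟨a₀, ha₀, ha₀F⟩ : ∃ a ∈ H, a ∉ F := by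
    by_contra! hcon
    have := Finset.card_le_card (show H ⊆ F from hcon)
    have := hF.2.1
    omega
  have hterm : ∀ a ∈ H, l a * P.eval (a : ℝ) ≤ 0 := fun a ha => by
    by_cases hla : 0 < l a
    · rw [hzero a ((hB a).2 ⟨ha, hla⟩), mul_zero]
    · by_cases haF : a ∈ F
      · rw [hPF a haF, mul_zero]
      · exact mul_nonpos_of_nonpos_of_nonneg (not_lt.1 hla) (hPpos a ha haF).le
  have h1 := (Finset.sum_eq_zero_iff_of_nonpos hterm).1 (hl.sum_eval hdeg) a₀ ha₀
  exact mul_ne_zero (hl0 a₀ ha₀) (hPpos a₀ ha₀ ha₀F).ne' h1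

/-- The sign of the product of differences of one value of a strictly monotone family. -/
lemma prod_sub_mul_neg_one_pow_pos {n : ℕ} {h : Fin n → ℕ} (hmono : StrictMono h) (i : Fin n) :
    0 < (∏ j ∈ (Finset.image h Finset.univ).erase (h i), ((h i : ℝ) - j)) *
      (-1) ^ (n - 1 - i.1) := by
  have h1 : (Finset.image h Finset.univ).erase (h i)
      = Finset.image h (Finset.univ.erase i) := by
    rw [Finset.image_erase hmono.injective]
  have h2 : (Finset.univ : Finset (Fin n)).erase i = Finset.Iio i ∪ Finset.Ioi i := by
    ext j; simp [lt_or_lt_iff_ne]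
  have h3 : Disjoint (Finset.Iio i) (Finset.Ioi i) :=
    Finset.disjoint_left.2 fun j hj hj' =>
      absurd (Finset.mem_Iio.1 hj) (Finset.mem_Ioi.1 hj').not_gt
  have h4 : (-1 : ℝ) ^ (n - 1 - i.1) = ∏ _j ∈ Finset.Ioi i, (-1 : ℝ) := by
    rw [Finset.prod_const, Fin.card_Ioi]
  rw [h1, Finset.prod_image hmono.injective.injOn, h2, Finset.prod_union h3, h4, mul_assoc,
    ← Finset.prod_mul_distrib]
  refine mul_pos (Finset.prod_pos fun j hj => ?_) (Finset.prod_pos fun j hj => ?_)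
  · exact sub_pos.2 (Nat.cast_lt.2 (hmono (Finset.mem_Iio.1 hj)))
  · have : (h i : ℝ) < h j := Nat.cast_lt.2 (hmono (Finset.mem_Ioi.1 hj))
    linarith

/-- the increasing bistellar flip of a triangulation of `C(m, 2d)` at a
`(2d+2)`-element subset `H = {h_0 < … < h_{2d+1}}` is again a triangulation, and its set
of `d`-faces lying in no lower facet is obtained from that of the original triangulation
by removing `A = {h_0, h_2, …, h_{2d}}` and adding `B = {h_1, h_3, …, h_{2d+1}}`. -/
theorem statement18 (d m : ℕ) (hd : 1 ≤ d) (hm : 2 * d + 2 ≤ m)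
    (h : Fin (2 * d + 2) → ℕ) (hmono : StrictMono h)
    (hrange : ∀ i, h i ∈ Finset.Icc 1 m)
    (H : Finset ℕ) (hH : H = Finset.image h Finset.univ)
    (A B : Finset ℕ)
    (hAdef : A = Finset.image
      (fun i : Fin (d + 1) => h ⟨2 * i.1, by have := i.isLt; omega⟩) Finset.univ)
    (hBdef : B = Finset.image
      (fun i : Fin (d + 1) => h ⟨2 * i.1 + 1, by have := i.isLt; omega⟩) Finset.univ)
    (T : Finset (Finset ℕ)) (hT : IsTriangulation m (2 * d) T)
    (hL : LH (2 * d) H ⊆ T)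
    (T' : Finset (Finset ℕ)) (hT'def : T' = (T \ LH (2 * d) H) ∪ UH (2 * d) H) :
    IsTriangulation m (2 * d) T' ∧
    {X : Finset ℕ | X.card = d + 1 ∧ IsFace T' X ∧
        ¬ ∃ F : Finset ℕ, IsLowerFacet m (2 * d) F ∧ smp (2 * d) X ⊆ smp (2 * d) F}
      = ({X : Finset ℕ | X.card = d + 1 ∧ IsFace T X ∧
          ¬ ∃ F : Finset ℕ, IsLowerFacet m (2 * d) F ∧ smp (2 * d) X ⊆ smp (2 * d) F}
            \ {A}) ∪ {B} := by
  have hHcard : H.card = 2 * d + 2 := by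
    rw [hH, Finset.card_image_of_injective _ hmono.injective, Finset.card_fin]
  have hHm : H ⊆ Finset.Icc 1 m := by
    rw [hH]
    intro x hx
    obtain ⟨i, -, rfl⟩ := Finset.mem_image.1 hx
    exact hrange i
  set l : ℕ → ℝ := fun c => (∏ j ∈ H.erase c, ((c : ℝ) - j))⁻¹ with hl_def
  have hl : IsAffDep (2 * d) H l := isAffDep_inv_prod hHcard
  have hodd : ∀ i : Fin (2 * d + 2), Odd i.1 → 0 < l (h i) := by
    intro i hi
    have hs := prod_sub_mul_neg_one_pow_pos hmono i
    rw [← hH, Even.neg_one_pow (by have := i.2; grind), mul_one] at hs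
    exact inv_pos.2 hs
  have heven : ∀ i : Fin (2 * d + 2), Even i.1 → l (h i) < 0 := by
    intro i hi
    have hs := prod_sub_mul_neg_one_pow_pos hmono i
    rw [← hH, Odd.neg_one_pow (by have := i.2; grind), mul_neg_one] at hs
    exact inv_lt_zero.2 (neg_pos.1 hs)
  have hl0 : ∀ a ∈ H, l a ≠ 0 := by
    intro a ha
    rw [hH] at ha
    obtain ⟨i, -, rfl⟩ := Finset.mem_image.1 ha
    rcases Nat.even_or_odd i.1 with hi | hi
    · exact (heven i hi).ne
    · exact (hodd i hi).ne'
  have hA : ∀ a, a ∈ A ↔ a ∈ H ∧ l a < 0 := by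
    intro a
    rw [hAdef, hH]
    constructor
    · intro ha
      obtain ⟨i, -, rfl⟩ := Finset.mem_image.1 ha
      exact ⟨Finset.mem_image_of_mem _ (Finset.mem_univ _), heven _ (even_two_mul _)⟩
    · rintro ⟨ha, hla⟩
      obtain ⟨i, -, rfl⟩ := Finset.mem_image.1 ha
      rcases Nat.even_or_odd' i.1 with ⟨k, hk | hk⟩
      · exact Finset.mem_image.2 ⟨⟨k, by omega⟩, Finset.mem_univ _, congrArg h (Fin.ext hk.symm)⟩
      · exact absurd hla (hodd i ⟨k, hk⟩).not_gt
  have hB : ∀ b, b ∈ B ↔ b ∈ H ∧ 0 < l b := by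
    intro a
    rw [hBdef, hH]
    constructor
    · intro ha
      obtain ⟨i, -, rfl⟩ := Finset.mem_image.1 ha
      exact ⟨Finset.mem_image_of_mem _ (Finset.mem_univ _), hodd _ (odd_two_mul_add_one _)⟩
    · rintro ⟨ha, hla⟩
      obtain ⟨i, -, rfl⟩ := Finset.mem_image.1 ha
      rcases Nat.even_or_odd' i.1 with ⟨k, hk | hk⟩
      · exact absurd hla (heven i ⟨k, by omega⟩).not_gt
      · exact Finset.mem_image.2 ⟨⟨k, by omega⟩, Finset.mem_univ _, congrArg h (Fin.ext hk.symm)⟩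
  have hAcard : A.card = d + 1 := by
    rw [hAdef, Finset.card_image_of_injective, Finset.card_fin]
    intro i j hij
    have := congrArg Fin.val (hmono.injective hij)
    exact Fin.ext (by simpa using this)
  have hBcard : B.card = d + 1 := by
    rw [hBdef, Finset.card_image_of_injective, Finset.card_fin]
    intro i j hij
    have := congrArg Fin.val (hmono.injective hij)
    exact Fin.ext (by simpa using this)
  have hLmem : ∀ G, G ∈ LH (2 * d) H ↔ ∃ b ∈ H, 0 < l b ∧ G = H.erase b := by
    intro G
    simp only [LH, Finset.mem_image, Finset.mem_filter, isLowerFacetOfSimplex_iff hHcard, hl_def,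
      inv_pos]
    grind
  have hUmem : ∀ G, G ∈ UH (2 * d) H ↔ ∃ a ∈ H, l a < 0 ∧ G = H.erase a := by
    intro G
    simp only [UH, Finset.mem_image, Finset.mem_filter, isUpperFacetOfSimplex_iff hHcard, hl_def,
      inv_lt_zero]
    grind
  obtain ⟨a₀, ha₀⟩ : A.Nonempty := Finset.card_pos.1 (by omega)
  obtain ⟨b₀, hb₀⟩ : B.Nonempty := Finset.card_pos.1 (by omega)
  have hpos : ∃ b ∈ H, 0 < l b := ⟨b₀, (hB _).1 hb₀⟩
  refine ⟨hT'def ▸ hT.flip hHm hHcard hl hl0 hpos ⟨a₀, (hA _).1 ha₀⟩ hLmem hUmem hL, ?_⟩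
  have hBH : B ⊆ H := fun b hb => ((hB b).1 hb).1
  have hdisj : ∀ a ∈ A, a ∉ B := fun a ha hb => ((hA a).1 ha).2.not_gt ((hB a).1 hb).2
  have hnotsub : ∀ X Y : Finset ℕ, X.card = d + 1 → Y.card = d + 1 → X ≠ Y → ∃ y ∈ Y, y ∉ X :=
    fun X Y hX hY hne => by
      by_contra! hcon
      exact hne (Finset.eq_of_subset_of_card_le hcon (by omega)).symm
  subst hT'def
  ext X
  simp only [Set.mem_ofPred_eq, Set.mem_union, Set.mem_sdiff, Set.mem_singleton_iff]
  constructor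
  · rintro ⟨hX, ⟨S, hS, hXS⟩, hlow⟩
    refine or_iff_not_imp_right.2 fun hXB => ?_
    rcases Finset.mem_union.1 hS with hS | hS
    · obtain ⟨hST, hSL⟩ := Finset.mem_sdiff.1 hS
      refine ⟨⟨hX, ⟨S, hST, hXS⟩, hlow⟩, ?_⟩
      rintro rfl
      exact hSL ((hLmem S).2 (eq_erase_of_negative_subset hT hHcard hl hl0 hpos
        (fun b hb hlb => hL ((hLmem _).2 ⟨b, hb, hlb, rfl⟩)) hST
        fun a ha hla => hXS ((hA a).2 ⟨ha, hla⟩)))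
    · obtain ⟨a, haH, hla, rfl⟩ := (hUmem S).1 hS
      obtain ⟨b, hb, hbX⟩ := hnotsub X B hX hBcard hXB
      refine ⟨⟨hX, ⟨H.erase b, hL ((hLmem _).2 ⟨b, hBH hb, ((hB b).1 hb).2, rfl⟩),
        Finset.subset_erase.2 ⟨hXS.trans (Finset.erase_subset _ _), hbX⟩⟩, hlow⟩, ?_⟩
      rintro rfl
      exact Finset.notMem_erase a H (hXS ((hA a).2 ⟨haH, hla⟩))
  · rintro (⟨⟨hX, ⟨S, hS, hXS⟩, hlow⟩, hXA⟩ | rfl)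
    · refine ⟨hX, ?_, hlow⟩
      by_cases hSL : S ∈ LH (2 * d) H
      · obtain ⟨b, hbH, hlb, rfl⟩ := (hLmem S).1 hSL
        obtain ⟨a, ha, haX⟩ := hnotsub X A hX hAcard hXA
        exact ⟨H.erase a, Finset.mem_union_right _
          ((hUmem _).2 ⟨a, ((hA a).1 ha).1, ((hA a).1 ha).2, rfl⟩),
          Finset.subset_erase.2 ⟨hXS.trans (Finset.erase_subset _ _), haX⟩⟩
      · exact ⟨S, Finset.mem_union_left _ (Finset.mem_sdiff.2 ⟨hS, hSL⟩), hXS⟩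
    · refine ⟨hBcard, ⟨H.erase a₀, Finset.mem_union_right _
        ((hUmem _).2 ⟨a₀, ((hA _).1 ha₀).1, ((hA _).1 ha₀).2, rfl⟩),
        Finset.subset_erase.2 ⟨hBH, hdisj a₀ ha₀⟩⟩, ?_⟩
      rintro ⟨F, hF, hsub⟩
      exact not_smp_subset_lowerFacet (by omega) hHm hHcard hl hl0 hB hF hsub
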